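/- arXiv:1709.05049 — 3 statements merged into one kernel-verified Lean document; each statement's English description precedes it below -/
import Mathlib

section
/- Let i, j ∈ Q_0 and let λ ∈ e_iΛe_j be nonzero. If l ∈ e_iΛe_i and l' ∈ e_jΛe_j satisfy lλ = λl', then l ∈ e_i(rad Λ)e_i if and only if l' ∈ e_j(rad Λ)e_j. -/
/-!
Common framework for formalizing statements from
"From support τ-tilting posets to algebras" (R. Kase).

Modules over the basic finite dimensional algebra `Λ` are taken to be *right*
modules, encoded as (left) modules over the opposite ring `Λᵐᵒᵖ`.
τ-rigidity is encoded through the Auslander–Smalø criterion: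
`Hom(M, τM) = 0` iff `Ext¹(M, Fac M) = 0`, and the vanishing of `Ext¹(M, X)`
is encoded by the splitting of all short exact sequences `0 → X → E → M → 0`.
-/

open MulOpposite

namespace TauTilting

/-- Bundled modules over `A` (in `Type 0`). -/
abbrev Mdl (A : Type) [Ring A] := ModuleCat.{0} A

variable {A B : Type} [Ring A] [Ring B]

/-- `X ∈ Fac M` : `X` is a factor of a finite direct sum of copies of `M`. -/
def MemFac (M X : Mdl A) : Prop :=
  ∃ (n : ℕ) (f : (Fin n → M) →ₗ[A] X), Function.Surjective f

/-- Every short exact sequence `0 → X → E → M → 0` splits, i.e. `Ext¹(M, X) = 0`. -/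
def Ext1Vanish (M X : Mdl A) : Prop :=
  ∀ (E : Mdl A) (f : X →ₗ[A] E) (g : E →ₗ[A] M),
    Function.Injective f → Function.Surjective g →
    LinearMap.range f = LinearMap.ker g →
    ∃ s : M →ₗ[A] E, g.comp s = LinearMap.id

/-- `M` is τ-rigid (Auslander–Smalø: `Hom(M, τM) = 0 ↔ Ext¹(M, Fac M) = 0`). -/
def IsTauRigid (M : Mdl A) : Prop :=
  Module.Finite A M ∧ ∀ X : Mdl A, MemFac M X → Ext1Vanish M X

/-- `M` is indecomposable. -/
def IsIndec (M : Mdl A) : Prop :=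
  Nontrivial M ∧ ∀ N N' : Submodule A M, IsCompl N N' → N = ⊥ ∨ N' = ⊥

/-- `F` is an (internal) decomposition of `M` into indecomposable direct summands. -/
def IsDecompOf (M : Mdl A) {n : ℕ} (F : Fin n → Submodule A M) : Prop :=
  iSupIndep F ∧ iSup F = ⊤ ∧ ∀ k, IsIndec (ModuleCat.of A (F k))

/-- `|M| = n` : `M` decomposes into `n` indecomposable direct summands. -/
def HasNumSummands (M : Mdl A) (n : ℕ) : Prop :=
  ∃ F : Fin n → Submodule A M, IsDecompOf M F

/-- `M` is basic: its indecomposable direct summands are pairwise non-isomorphic. -/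
def IsBasicMod (M : Mdl A) : Prop :=
  ∃ (n : ℕ) (F : Fin n → Submodule A M), IsDecompOf M F ∧
    ∀ k l : Fin n, k ≠ l → IsEmpty (↥(F k) ≃ₗ[A] ↥(F l))

def ModIso (M N : Mdl A) : Prop := Nonempty (M ≃ₗ[A] N)

/-- The order on support τ-tilting modules: `M ≤ N ↔ Fac M ⊆ Fac N`. -/
def FacLE (M N : Mdl A) : Prop := ∀ X : Mdl A, MemFac M X → MemFac N X
def FacLT (M N : Mdl A) : Prop := FacLE M N ∧ ¬ FacLE N M
/-- Equality in the poset of iso-classes: mutual `≤`. -/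
def PE (M N : Mdl A) : Prop := FacLE M N ∧ FacLE N M

/-- `N` is a direct summand of `M`. -/
def IsSummand (N M : Mdl A) : Prop :=
  ∃ (f : N →ₗ[A] M) (g : M →ₗ[A] N), g.comp f = LinearMap.id
/-- `N ∈ add M`. -/
def InAdd (N M : Mdl A) : Prop := ∃ n : ℕ, IsSummand N (ModuleCat.of A (Fin n → M))
def HomZero (R M : Mdl A) : Prop := ∀ f : R →ₗ[A] M, f = 0

/-- Direct sum of two bundled modules. -/
def dsum (M N : Mdl A) : Mdl A := ModuleCat.of A (M × N)

/-- Hasse-quiver arrow `M → N` (so `N` is a direct successor of `M`, and `M` a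
direct predecessor of `N`) in the poset of all modules satisfying `P`,
ordered by `FacLE`. -/
def HArrow (P : Mdl A → Prop) (M N : Mdl A) : Prop :=
  P M ∧ P N ∧ FacLT N M ∧ ∀ C, P C → FacLT N C → FacLT C M → False

def IsMaxOf (P : Mdl A → Prop) (T : Mdl A) : Prop := P T ∧ ∀ S, P S → FacLE S T
def IsMinOf (P : Mdl A → Prop) (T : Mdl A) : Prop := P T ∧ ∀ S, P S → FacLE T S

/-- `T` has exactly `n` direct successors (counted up to poset equality). -/
def SuccsCard (P : Mdl A → Prop) (T : Mdl A) (n : ℕ) : Prop :=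
  ∃ g : Fin n → Mdl A, (∀ k, HArrow P T (g k)) ∧
    (∀ k l, k ≠ l → ¬ PE (g k) (g l)) ∧ ∀ S, HArrow P T S → ∃ k, PE S (g k)

/-- `T` has exactly `n` direct predecessors (counted up to poset equality). -/
def PredsCard (P : Mdl A → Prop) (T : Mdl A) (n : ℕ) : Prop :=
  ∃ g : Fin n → Mdl A, (∀ k, HArrow P (g k) T) ∧
    (∀ k l, k ≠ l → ¬ PE (g k) (g l)) ∧ ∀ S, HArrow P S T → ∃ k, PE S (g k)

/-- The poset of modules satisfying `P` (ordered by `FacLE`) is a lattice. -/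
def IsLatticeP (P : Mdl A → Prop) : Prop :=
  ∀ M N, P M → P N →
    (∃ J, P J ∧ FacLE M J ∧ FacLE N J ∧ ∀ C, P C → FacLE M C → FacLE N C → FacLE J C) ∧
    (∃ W, P W ∧ FacLE W M ∧ FacLE W N ∧ ∀ C, P C → FacLE C M → FacLE C N → FacLE C W)

/-- A poset isomorphism between the posets (of isomorphism classes) of modules
satisfying `PA` resp. `PB`, ordered by `FacLE`. -/
structure PosetIsoP (PA : Mdl A → Prop) (PB : Mdl B → Prop) where
  toFun : Mdl A → Mdl B
  invFun : Mdl B → Mdl A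
  maps : ∀ M, PA M → PB (toFun M)
  maps' : ∀ N, PB N → PA (invFun N)
  le_iff : ∀ M N, PA M → PA N → (FacLE M N ↔ FacLE (toFun M) (toFun N))
  le_iff' : ∀ M N, PB M → PB N → (FacLE M N ↔ FacLE (invFun M) (invFun N))
  left_inv : ∀ M, PA M → PE (invFun (toFun M)) M
  right_inv : ∀ N, PB N → PE (toFun (invFun N)) N

/-- A poset isomorphism between the poset of modules satisfying `P` and an
abstract poset `(β, le)`. -/
structure PosetIsoTo (P : Mdl A → Prop) (β : Type) (le : β → β → Prop) where
  toFun : Mdl A → β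
  invFun : β → Mdl A
  maps' : ∀ b, P (invFun b)
  le_iff : ∀ M N, P M → P N → (FacLE M N ↔ le (toFun M) (toFun N))
  left_inv : ∀ M, P M → PE (invFun (toFun M)) M
  right_inv : ∀ b, toFun (invFun b) = b

/-! ### Ring-level notions -/

variable (Λ : Type) [Ring Λ]

/-- The right ideal generated by a subset, as a right module (i.e. `Λᵐᵒᵖ`-module). -/
def rSpan (S : Set Λ) : Submodule Λᵐᵒᵖ Λ := Submodule.span Λᵐᵒᵖ S
/-- The two-sided ideal `(q) = ΛqΛ`, as a right `Λ`-module. -/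
def tIdeal (q : Λ) : Submodule Λᵐᵒᵖ Λ := Submodule.span Λᵐᵒᵖ {y : Λ | ∃ a : Λ, y = a * q}
/-- The right `Λ`-module `Λ/S`. -/
def quotMod (S : Submodule Λᵐᵒᵖ Λ) : Mdl Λᵐᵒᵖ := ModuleCat.of Λᵐᵒᵖ (Λ ⧸ S)
/-- `Λ` as a right module over itself. -/
def regMod : Mdl Λᵐᵒᵖ := ModuleCat.of Λᵐᵒᵖ Λ
/-- The projective right module `xΛ ≅ Λ/(1-x)Λ` attached to an idempotent `x`. -/
def projMod (x : Λ) : Mdl Λᵐᵒᵖ := quotMod Λ (rSpan Λ {1 - x})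
/-- The right `Λ`-module `Λ/(1-x)`; for `x = e i` this is the module `X_i`. -/
def cyclicQuot (x : Λ) : Mdl Λᵐᵒᵖ := quotMod Λ (tIdeal Λ (1 - x))

/-- `x` is a primitive idempotent. -/
def IsPrimIdem (x : Λ) : Prop :=
  IsIdempotentElem x ∧ x ≠ 0 ∧
    ∀ a b : Λ, IsIdempotentElem a → IsIdempotentElem b →
      a * b = 0 → b * a = 0 → a + b = x → a = 0 ∨ b = 0

variable {ι : Type} [Fintype ι]

/-- `e` is a complete family of orthogonal primitive idempotents of `Λ`. -/
def CompletePrimIdems (e : ι → Λ) : Prop :=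
  (∀ i, IsPrimIdem Λ (e i)) ∧ (Pairwise fun i j => e i * e j = 0) ∧ ∑ i, e i = 1

/-- `Λ` is basic w.r.t. `e`: the `e i Λ` are pairwise non-isomorphic. -/
def IsBasicAlg (e : ι → Λ) : Prop :=
  ∀ i j : ι, i ≠ j → IsEmpty (↥(projMod Λ (e i)) ≃ₗ[Λᵐᵒᵖ] ↥(projMod Λ (e j)))

/-- The support `supp(M) = {i | M·eᵢ ≠ 0}` of a right module `M`. -/
def Supp (e : ι → Λ) (M : Mdl Λᵐᵒᵖ) : Set ι := {i | ∃ m : M, op (e i) • m ≠ 0}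

/-- Support τ-tilting module: τ-rigid with `|M| = #supp(M)`. -/
def IsSTT (e : ι → Λ) (M : Mdl Λᵐᵒᵖ) : Prop :=
  Module.Finite Λᵐᵒᵖ M ∧ IsTauRigid M ∧ HasNumSummands M (Supp Λ e M).ncard

/-- Basic support τ-tilting module. -/
def IsBSTT (e : ι → Λ) (M : Mdl Λᵐᵒᵖ) : Prop := IsSTT Λ e M ∧ IsBasicMod M

/-- τ-tilting module: τ-rigid with `|M| = #Q₀`. -/
def IsTauTiltingMod (e : ι → Λ) (M : Mdl Λᵐᵒᵖ) : Prop :=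
  IsSTT Λ e M ∧ HasNumSummands M (Fintype.card ι)

open scoped Classical in
/-- The idempotent `1 - e_M = Σ_{i ∉ supp M} e i`. -/
noncomputable def cIdem (e : ι → Λ) (M : Mdl Λᵐᵒᵖ) : Λ :=
  ∑ i : ι, if i ∈ Supp Λ e M then 0 else e i

/-- τ-rigid pair `(M, P)`. -/
def IsTauRigidPair (e : ι → Λ) (M P : Mdl Λᵐᵒᵖ) : Prop :=
  IsTauRigid M ∧ Module.Finite Λᵐᵒᵖ P ∧ Module.Projective Λᵐᵒᵖ P ∧
    InAdd P (projMod Λ (cIdem Λ e M))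

/-- Basic τ-rigid pair. -/
def IsBasicTRP (e : ι → Λ) (M P : Mdl Λᵐᵒᵖ) : Prop :=
  IsTauRigidPair Λ e M P ∧ IsBasicMod M ∧ IsBasicMod P

/-- `T ∈ sτtilt_{(N,R)} Λ`, i.e. `N ∈ add T` and `Hom(R, T) = 0`. -/
def InPairSet (N R T : Mdl Λᵐᵒᵖ) : Prop := InAdd N T ∧ HomZero R T

/-- `Λ` is τ-tilting finite: finitely many basic support τ-tilting modules up to iso. -/
def TauTiltingFinite (e : ι → Λ) : Prop :=
  ∃ (n : ℕ) (T : Fin n → Mdl Λᵐᵒᵖ), ∀ M, IsBSTT Λ e M → ∃ k, ModIso M (T k)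

/-- The Jacobson radical of `Λ`, as a `K`-subspace. -/
noncomputable def radK (K : Type) [CommRing K] (Λ : Type) [Ring Λ] [Algebra K Λ] :
    Submodule K Λ :=
  Submodule.restrictScalars K (sInf {I : Ideal Λ | I.IsMaximal})

/-- Powers of the radical, with `rad⁰ = Λ`. -/
noncomputable def radPow (K : Type) [CommRing K] (Λ : Type) [Ring Λ] [Algebra K Λ] :
    ℕ → Submodule K Λ
  | 0 => ⊤
  | n + 1 => radK K Λ ^ (n + 1)

/-! ### Quivers, paths and presentations -/

/-- Paths in a quiver with vertex set `ι` and arrow types `Arr i j`. -/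
inductive QPath {ι : Type} (Arr : ι → ι → Type) : ι → ι → Type
  | nil (i : ι) : QPath Arr i i
  | cons {i j k : ι} (a : Arr i j) (p : QPath Arr j k) : QPath Arr i k

namespace QPath

variable {ι : Type} {Arr : ι → ι → Type}

/-- The list of visited vertices. -/
def verts : ∀ {i j : ι}, QPath Arr i j → List ι
  | i, _, .nil _ => [i]
  | i, _, .cons _ p => i :: p.verts

/-- Evaluation of a path in the algebra `Λ` (trivial path at `i` ↦ `e i`). -/
def eval {Λ : Type} [Ring Λ] (e : ι → Λ) (arr : ∀ i j, Arr i j → Λ) :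
    ∀ {i j : ι}, QPath Arr i j → Λ
  | _, _, .nil i => e i
  | _, _, .cons a p => arr _ _ a * p.eval e arr

def append : ∀ {i j k : ι}, QPath Arr i j → QPath Arr j k → QPath Arr i k
  | _, _, _, .nil _, q => q
  | _, _, _, .cons a p, q => .cons a (p.append q)

def single {i j : ι} (a : Arr i j) : QPath Arr i j := .cons a (.nil j)

end QPath

/-- The condition `xΛe_j = e_iΛe_j = e_iΛx ≠ 0` on an element `x` of `e_iΛe_j`. -/
def Gcond (ei ej x : Λ) : Prop :=
  (Set.range fun b => x * b * ej) = (Set.range fun b => ei * b * ej) ∧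
  (Set.range fun b => ei * b * x) = (Set.range fun b => ei * b * ej) ∧
  ∃ b, ei * b * ej ≠ 0

/-- `w ∈ G(Q, I)` : `w` contains no cycle as a subpath (equivalently, visits no
vertex twice) and `wΛe_j = e_iΛe_j = e_iΛw ≠ 0`. -/
def GMem (e : ι → Λ) {Arr : ι → ι → Type} (arr : ∀ i j, Arr i j → Λ) {i j : ι}
    (w : QPath Arr i j) : Prop :=
  w.verts.Nodup ∧ Gcond Λ (e i) (e j) (w.eval e arr)

/-- Condition 1 for a bound quiver: if `e_iΛe_j ≠ 0` then `G^i_j ≠ ∅`. -/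
def Cond1 (e : ι → Λ) {Arr : ι → ι → Type} (arr : ∀ i j, Arr i j → Λ) : Prop :=
  ∀ i j : ι, (∃ x, e i * x * e j ≠ 0) → ∃ w : QPath Arr i j, GMem Λ e arr w

/-- Ring-level version of Condition 1 (Lemma `eqcd` (iii)). -/
def Cond1R : Prop :=
  ∀ x y : Λ, IsPrimIdem Λ x → IsPrimIdem Λ y → x * y = 0 → y * x = 0 →
    ∃ w : Λ, (∃ b, w = x * b * y) ∧
      (Set.range fun b => w * b * y) = (Set.range fun b => x * b * y) ∧
      (Set.range fun b => x * b * w) = (Set.range fun b => x * b * y)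

/-- `(e, Arr, arr)` presents `Λ` as the bound quiver algebra `KQ/I` with `Q` its
Gabriel quiver: `e` is a complete family of orthogonal primitive idempotents,
`Λ` is basic, each arrow `a : i → j` is sent to an element of `e_i (rad Λ) e_j`,
and the arrows form a `K`-basis of `rad Λ / rad² Λ`. -/
def IsGabrielPres (K : Type) [Field K] [Algebra K Λ] [DecidableEq ι] (e : ι → Λ)
    (Arr : ι → ι → Type) [∀ i j, Fintype (Arr i j)] (arr : ∀ i j, Arr i j → Λ) : Prop :=
  CompletePrimIdems Λ e ∧ IsBasicAlg Λ e ∧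
  (∀ i j (a : Arr i j), arr i j a ∈ radK K Λ ∧ e i * arr i j a * e j = arr i j a) ∧
  (radK K Λ ≤
    Submodule.span K (Set.range fun p : Σ i : ι, Σ j : ι, Arr i j => arr p.1 p.2.1 p.2.2) ⊔
      radK K Λ * radK K Λ) ∧
  (∀ c : (Σ i : ι, Σ j : ι, Arr i j) → K,
    (∑ p : Σ i : ι, Σ j : ι, Arr i j, c p • arr p.1 p.2.1 p.2.2) ∈ radK K Λ * radK K Λ →
    ∀ p, c p = 0)

/-! ### Partitions of a quiver, Condition 2 -/

/-- `x` and `y` are adjacent within the vertex subset `S` (undirected). -/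
def AdjIn {ι : Type} (Arr : ι → ι → Type) (S : Set ι) (x y : ι) : Prop :=
  x ∈ S ∧ y ∈ S ∧ (Nonempty (Arr x y) ∨ Nonempty (Arr y x))

/-- The full subquiver on `S` is connected. -/
def ConnectedOn {ι : Type} (Arr : ι → ι → Type) (S : Set ι) : Prop :=
  ∀ x ∈ S, ∀ y ∈ S, Relation.ReflTransGen (AdjIn Arr S) x y

/-- Adjacency of parts in the quotient quiver `Q^μ`. -/
def PartAdj {ι : Type} (Arr : ι → ι → Type) {ℓ : ℕ} (μ : ι → Fin ℓ) (u v : Fin ℓ) : Prop :=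
  u ≠ v ∧ ∃ x y, μ x = u ∧ μ y = v ∧ (Nonempty (Arr x y) ∨ Nonempty (Arr y x))

/-- Condition 2: there is a partition `μ` of `Q₀` into connected full subquivers
such that `Q^μ` is a tree (connected with `#arrows = #parts - 1`) and each
`sτtilt Λ^{a,b}_μ` — identified with the subposet of `sτtilt Λ` of modules
supported on the union of the two parts — is a lattice. -/
def Cond2 (e : ι → Λ) (Arr : ι → ι → Type) [∀ i j, Fintype (Arr i j)] : Prop :=
  ∃ (ℓ : ℕ) (μ : ι → Fin ℓ), Function.Surjective μ ∧
    (∀ a : Fin ℓ, ConnectedOn Arr {i | μ i = a}) ∧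
    (∀ u v : Fin ℓ, Relation.ReflTransGen (PartAdj Arr μ) u v) ∧
    Nat.card {p : Σ i : ι, Σ j : ι, Arr i j // μ p.1 ≠ μ p.2.1} = ℓ - 1 ∧
    ∀ a b : Fin ℓ, a ≠ b →
      IsLatticeP (fun T : Mdl Λᵐᵒᵖ => IsBSTT Λ e T ∧ Supp Λ e T ⊆ {i | μ i = a ∨ μ i = b})

/-! ### Correspondence of paths under a quiver isomorphism, and `∼` -/

/-- Transport of paths along a quiver isomorphism `σ : Q° → (Q')°` (defined on
non-loop arrows). -/
inductive PathCorr {ι ι' : Type} {Arr : ι → ι → Type} {Arr' : ι' → ι' → Type}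
    (σ : ι → ι') (σ1 : ∀ i j, i ≠ j → Arr i j → Arr' (σ i) (σ j)) :
    ∀ {i j : ι}, QPath Arr i j → QPath Arr' (σ i) (σ j) → Prop
  | nil (i : ι) : PathCorr σ σ1 (QPath.nil i) (QPath.nil (σ i))
  | cons {i j k : ι} (h : i ≠ j) (a : Arr i j) {p : QPath Arr j k}
      {p' : QPath Arr' (σ j) (σ k)} :
      PathCorr σ σ1 p p' → PathCorr σ σ1 (QPath.cons a p) (QPath.cons (σ1 i j h a) p')

/-- The relation `(Q, I) ∼ (Q', I')`: there is a quiver isomorphism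
`σ : Q° → (Q')°` with (a) `supp(e_{σ(i)}Γ) = σ(supp(e_iΛ))` and (b) `G(Γ) = σ(G(Λ))`. -/
def SimCond {Λ Γ : Type} [Ring Λ] [Ring Γ] {ι ι' : Type}
    (e : ι → Λ) {Arr : ι → ι → Type} (arr : ∀ i j, Arr i j → Λ)
    (f : ι' → Γ) {Arr' : ι' → ι' → Type} (arr' : ∀ i j, Arr' i j → Γ) : Prop :=
  ∃ (σ : ι ≃ ι') (σ1 : ∀ i j, i ≠ j → (Arr i j ≃ Arr' (σ i) (σ j))),
    (∀ i j : ι, (∃ x, e i * x * e j ≠ 0) ↔ ∃ y, f (σ i) * y * f (σ j) ≠ 0) ∧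
    (∀ (i j : ι) (w : QPath Arr i j), GMem Λ e arr w →
      ∃ w' : QPath Arr' (σ i) (σ j),
        PathCorr σ (fun i j h => σ1 i j h) w w' ∧ GMem Γ f arr' w') ∧
    (∀ (i j : ι) (w' : QPath Arr' (σ i) (σ j)), GMem Γ f arr' w' →
      ∃ w : QPath Arr i j,
        PathCorr σ (fun i j h => σ1 i j h) w w' ∧ GMem Λ e arr w)

end TauTilting

section Fitting

open Polynomial

/-- If `x` is left invertible relative to `e`, then `x` and its powers are left cancellable on
elements fixed by `e`. -/
lemma eq_zero_of_pow_mul_eq_zero {R : Type*} [Ring R] {e x y v : R} (hex : e * x = x)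
    (hyx : y * x = e) (hev : e * v = v) {n : ℕ} (h : x ^ n * v = 0) : v = 0 := by
  induction n with
  | zero => simpa using h
  | succ n ih =>
    apply ih
    have hfix : e * (x ^ n * v) = x ^ n * v := by
      cases n with
      | zero => simpa using hev
      | succ n => rw [pow_succ', mul_assoc, ← mul_assoc e, hex]
    rw [← hfix, ← hyx, mul_assoc, ← mul_assoc x, ← pow_succ', h, mul_zero]

lemma eq_zero_of_mul_pow_eq_zero {R : Type*} [Ring R] {e x y v : R} (hxe : x * e = x)
    (hxy : x * y = e) (hve : v * e = v) {n : ℕ} (h : v * x ^ n = 0) : v = 0 := by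
  induction n with
  | zero => simpa using h
  | succ n ih =>
    apply ih
    have hfix : v * x ^ n * e = v * x ^ n := by
      cases n with
      | zero => simpa using hve
      | succ n => rw [pow_succ, mul_assoc, mul_assoc, hxe]
    rw [← hfix, ← hxy, ← mul_assoc, mul_assoc v, ← pow_succ, h, zero_mul]

/-- Fitting's lemma for an element of the corner ring of a primitive idempotent. -/
lemma TauTilting.IsPrimIdem.isNilpotent_or_exists_inverse {K Λ : Type} [Field K] [Ring Λ]
    [Algebra K Λ] [FiniteDimensional K Λ] {e x : Λ} (he : TauTilting.IsPrimIdem Λ e)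
    (hex : e * x = x) (hxe : x * e = x) :
    IsNilpotent x ∨ ∃ y, y * x = e ∧ x * y = e := by
  obtain ⟨q, hq, hndvd⟩ := Polynomial.exists_eq_pow_rootMultiplicity_mul_and_not_dvd
    (minpoly K x) (minpoly.ne_zero (Algebra.IsIntegral.isIntegral x)) 0
  set n := (minpoly K x).rootMultiplicity 0
  rw [map_zero, sub_zero] at hq hndvd
  have hcop : IsCoprime (X ^ (n + 1)) q :=
    ((irreducible_X.coprime_iff_not_dvd).2 hndvd).pow_left
  obtain ⟨a, b, hab⟩ := hcop
  have hzero : aeval x (X ^ (n + 1) * q) = 0 := by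
    rw [pow_succ', mul_assoc, ← hq, map_mul, minpoly.aeval, mul_zero]
  set f := aeval x (a * X ^ (n + 1)) with hf
  have hf1 : 1 - f = aeval x (b * q) := by
    rw [hf, ← map_one (aeval (R := K) x), ← hab, map_add, add_sub_cancel_left]
  have hff : IsIdempotentElem f := by
    have h : f * (1 - f) = 0 := by
      rw [hf1, hf, ← map_mul,
        show a * X ^ (n + 1) * (b * q) = a * b * (X ^ (n + 1) * q) by ring, map_mul, hzero,
        mul_zero]
    rw [mul_sub, mul_one, sub_eq_zero] at h
    exact h.symm
  have hfr : f = aeval x (a * X ^ n) * x := by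
    rw [hf, pow_succ, ← mul_assoc, map_mul _ _ X, aeval_X]
  have hfl : f = x * aeval x (a * X ^ n) := by
    rw [hf, show a * X ^ (n + 1) = X * (a * X ^ n) by ring, map_mul, aeval_X]
  have hfe : f * e = f := by rw [hfr, mul_assoc, hxe]
  have hef : e * f = f := by rw [hfl, ← mul_assoc, hex]
  have hee : e * e = e := he.1
  have hff' : f * f = f := hff
  rcases he.2.2 f (e - f) hff
    (by simp only [IsIdempotentElem, mul_sub, sub_mul, hfe, hef, hee, hff']; abel)
    (by rw [mul_sub, hfe, hff', sub_self]) (by rw [sub_mul, hef, hff', sub_self])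
    (add_sub_cancel f e) with h | h
  · left
    refine ⟨n + 1, ?_⟩
    calc x ^ (n + 1) = x ^ (n + 1) * (1 - f) := by rw [h, sub_zero, mul_one]
      _ = aeval x (b * (X ^ (n + 1) * q)) := by
        rw [hf1, show b * (X ^ (n + 1) * q) = X ^ (n + 1) * (b * q) by ring,
          map_mul _ (X ^ (n + 1)), map_pow, aeval_X]
      _ = 0 := by rw [map_mul, hzero, mul_zero]
  · right
    rw [sub_eq_zero] at h
    exact ⟨_, hfr.symm.trans h.symm, hfl.symm.trans h.symm⟩

/-- In the corner ring of a primitive idempotent, the radical elements are the nilpotent ones. -/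
lemma TauTilting.IsPrimIdem.mem_radK_iff_isNilpotent {K Λ : Type} [Field K] [Ring Λ]
    [Algebra K Λ] [FiniteDimensional K Λ] {e x : Λ} (he : TauTilting.IsPrimIdem Λ e)
    (hex : e * x = x) (hxe : x * e = x) :
    x ∈ TauTilting.radK K Λ ↔ IsNilpotent x := by
  have hmem : x ∈ TauTilting.radK K Λ ↔ x ∈ Ideal.jacobson (⊥ : Ideal Λ) := by
    simp [TauTilting.radK, Ideal.jacobson]
  rw [hmem]
  constructor
  · intro hx
    refine (he.isNilpotent_or_exists_inverse (K := K) hex hxe).resolve_right ?_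
    rintro ⟨y, hyx, -⟩
    obtain ⟨z, hz⟩ := Ideal.mem_jacobson_iff.1 hx (-y)
    rw [Ideal.mem_bot, mul_assoc, neg_mul, hyx, sub_eq_zero] at hz
    apply he.2.1
    have hee : e * e = e := he.1
    calc e = (z * -e + z) * e := by rw [hz, one_mul]
      _ = 0 := by rw [add_mul, mul_assoc, neg_mul, hee, mul_neg, neg_add_cancel]
  · rintro ⟨n, hn⟩
    rw [Ideal.mem_jacobson_iff]
    intro y
    have hnil : IsNilpotent (e * y * x) := by
      refine (he.isNilpotent_or_exists_inverse (K := K) (x := e * y * x) ?_ ?_).resolve_right ?_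
      · rw [← mul_assoc, ← mul_assoc, he.1]
      · rw [mul_assoc, hxe]
      · rintro ⟨w, hw, -⟩
        exact he.2.1 (eq_zero_of_pow_mul_eq_zero (y := w * (e * y)) (n := n) hex
          (by rw [mul_assoc, hw]) he.1 (by rw [hn, zero_mul]))
    have hyx : IsNilpotent (y * x) := by
      obtain ⟨m, hm⟩ := hnil
      have hsemi : SemiconjBy e (y * x) (e * y * x) := by
        rw [SemiconjBy, mul_assoc (e * y), hxe, mul_assoc]
      refine ⟨m + 1, ?_⟩
      calc (y * x) ^ (m + 1)
          _ = y * x * (e * (y * x) ^ m) := by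
            rw [pow_succ', ← mul_assoc _ e, mul_assoc y x e, hxe]
          _ = 0 := by rw [(hsemi.pow_right m).eq, hm, zero_mul, mul_zero]
    obtain ⟨z, hz⟩ := hyx.isUnit_one_add.exists_left_inv
    refine ⟨z, ?_⟩
    rw [Ideal.mem_bot, ← hz]
    noncomm_ring

end Fitting

open TauTilting in
/-- Let `0 ≠ λ ∈ e_iΛe_j`.  If `l ∈ e_iΛe_i` and
`l' ∈ e_jΛe_j` satisfy `lλ = λl'`, then `l ∈ e_i(rad Λ)e_i` iff
`l' ∈ e_j(rad Λ)e_j` (equivalently, since `l = e_i l e_i` and `l' = e_j l' e_j`,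
`l ∈ rad Λ ↔ l' ∈ rad Λ`). -/
theorem statement16
    (K : Type) [Field K]
    (Λ : Type) [Ring Λ] [Algebra K Λ] [FiniteDimensional K Λ]
    (ι : Type) [Fintype ι] (e : ι → Λ)
    (he : CompletePrimIdems Λ e) (hbasic : IsBasicAlg Λ e)
    (i j : ι) (lam : Λ) (hlam : e i * lam * e j = lam) (hne : lam ≠ 0)
    (l l' : Λ) (hl : e i * l * e i = l) (hl' : e j * l' * e j = l')
    (hcomm : l * lam = lam * l') :
    l ∈ radK K Λ ↔ l' ∈ radK K Λ := by
  have hii : e i * e i = e i := (he.1 i).1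
  have hjj : e j * e j = e j := (he.1 j).1
  have hil : e i * l = l := by rw [← hl, ← mul_assoc, ← mul_assoc, hii]
  have hli : l * e i = l := by rw [← hl, mul_assoc, hii]
  have hjl : e j * l' = l' := by rw [← hl', ← mul_assoc, ← mul_assoc, hjj]
  have hlj : l' * e j = l' := by rw [← hl', mul_assoc, hjj]
  have hilam : e i * lam = lam := by rw [← hlam, ← mul_assoc, ← mul_assoc, hii]
  have hlamj : lam * e j = lam := by rw [← hlam, mul_assoc, hjj]
  have hsemi : SemiconjBy lam l' l := hcomm.symm
  rw [(he.1 i).mem_radK_iff_isNilpotent hil hli, (he.1 j).mem_radK_iff_isNilpotent hjl hlj]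
  constructor
  · rintro ⟨n, hn⟩
    refine ((he.1 j).isNilpotent_or_exists_inverse (K := K) hjl hlj).resolve_right ?_
    rintro ⟨y, -, hy⟩
    exact hne (eq_zero_of_mul_pow_eq_zero (n := n) hlj hy hlamj
      (by rw [(hsemi.pow_right n).eq, hn, zero_mul]))
  · rintro ⟨n, hn⟩
    refine ((he.1 i).isNilpotent_or_exists_inverse (K := K) hil hli).resolve_right ?_
    rintro ⟨y, hy, -⟩
    exact hne (eq_zero_of_pow_mul_eq_zero (n := n) hil hy hilam
      (by rw [← (hsemi.pow_right n).eq, hn, mul_zero]))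
end

section
/- Let e and f be primitive idempotents of Λ with eΛf ≠ 0, and set G^e_f := {w ∈ eΛf : wΛf = eΛf = eΛw}. If G^e_f ≠ ∅, then G^e_f = eΛf \ rad^{ℓ+1}Λ, where ℓ is the largest integer m ≥ 0 such that eΛf ⊆ rad^m Λ. -/
/-!
Common framework for formalizing statements from
"From support τ-tilting posets to algebras" (R. Kase).

Modules over the basic finite dimensional algebra `Λ` are taken to be *right*
modules, encoded as (left) modules over the opposite ring `Λᵐᵒᵖ`.
τ-rigidity is encoded through the Auslander–Smalø criterion:
`Hom(M, τM) = 0` iff `Ext¹(M, Fac M) = 0`, and the vanishing of `Ext¹(M, X)`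
is encoded by the splitting of all short exact sequences `0 → X → E → M → 0`.
-/

open MulOpposite

namespace TauTilting

/-- Fitting's lemma: an element of `fΛf`, with `f` primitive, is nilpotent or invertible in `fΛf`. -/
theorem IsPrimIdem.isNilpotent_or_exists_inv (K : Type) [Field K] {Λ : Type} [Ring Λ]
    [Algebra K Λ] [FiniteDimensional K Λ] {f : Λ} (hf : IsPrimIdem Λ f) {a : Λ}
    (hfa : f * a = a) (haf : a * f = a) :
    IsNilpotent a ∨ ∃ u, u * a = f ∧ a * u = f := by
  obtain ⟨p, hp0, hpa⟩ : ∃ p : Polynomial K, p ≠ 0 ∧ Polynomial.aeval a p = 0 :=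
    Algebra.IsAlgebraic.isAlgebraic (R := K) a
  obtain ⟨q, hpq, hq⟩ := Polynomial.exists_eq_pow_rootMultiplicity_mul_and_not_dvd p hp0 0
  rw [Polynomial.C_0, sub_zero] at hpq hq
  set n := p.rootMultiplicity 0
  obtain ⟨s, t, hst⟩ : IsCoprime (Polynomial.X ^ (n + 1)) q :=
    (Polynomial.prime_X.coprime_iff_not_dvd.2 hq).pow_left
  have hq0 : a ^ (n + 1) * Polynomial.aeval a q = 0 := by
    have := congrArg (Polynomial.aeval a) hpq
    rw [hpa, map_mul, map_pow, Polynomial.aeval_X] at this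
    rw [pow_succ', mul_assoc, ← this, mul_zero]
  set S := Polynomial.aeval a s
  set T := Polynomial.aeval a t
  set Q := Polynomial.aeval a q
  have h1 : S * a ^ (n + 1) + T * Q = 1 := by
    simpa using congrArg (Polynomial.aeval a) hst
  have hSa : Commute S a := by
    simpa [S] using (Polynomial.commute_X s).symm.map (Polynomial.aeval a)
  have hTa : Commute T a := by
    simpa [T] using (Polynomial.commute_X t).symm.map (Polynomial.aeval a)
  have haT : a ^ (n + 1) * (T * Q) = 0 := by
    rw [← mul_assoc, ← (hTa.pow_right (n + 1)).eq, mul_assoc, hq0, mul_zero]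
  have hPP : IsIdempotentElem (S * a ^ (n + 1)) := by
    have h : S * a ^ (n + 1) * (S * a ^ (n + 1) + T * Q) = S * a ^ (n + 1) := by
      rw [h1, mul_one]
    rwa [mul_add, mul_assoc S _ (T * Q), haT, mul_zero, add_zero] at h
  have hPf : S * a ^ (n + 1) * f = S * a ^ (n + 1) := by
    rw [pow_succ, mul_assoc, mul_assoc, haf]
  have hfP : f * (S * a ^ (n + 1)) = S * a ^ (n + 1) := by
    rw [(hSa.pow_right (n + 1)).eq, pow_succ', ← mul_assoc, ← mul_assoc, hfa]
  obtain ⟨hff, -, hprim⟩ := hf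
  rcases hprim (S * a ^ (n + 1)) (f - S * a ^ (n + 1)) hPP
    (by simp only [IsIdempotentElem, mul_sub, sub_mul, hff.eq, hPP.eq, hPf, hfP]; abel)
    (by rw [mul_sub, hPf, hPP.eq, sub_self]) (by rw [sub_mul, hfP, hPP.eq, sub_self])
    (by abel) with h | h
  · left
    refine ⟨n + 1, ?_⟩
    rw [h, zero_add] at h1
    simpa [h1] using haT
  · right
    have h := sub_eq_zero.1 h
    refine ⟨S * a ^ n, ?_, ?_⟩
    · rw [mul_assoc, ← pow_succ, ← h]
    · rw [← mul_assoc, ← hSa.eq, mul_assoc, ← pow_succ', ← h]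

/-- For `f` primitive, an element of `fΛf` outside the radical of `Λ` is invertible in `fΛf`. -/
theorem IsPrimIdem.mem_radK_or_exists_inv (K : Type) [Field K] {Λ : Type} [Ring Λ]
    [Algebra K Λ] [FiniteDimensional K Λ] {f : Λ} (hf : IsPrimIdem Λ f) {b : Λ}
    (hfb : f * b = b) (hbf : b * f = b) :
    b ∈ radK K Λ ∨ ∃ u, u * b = f ∧ b * u = f := by
  rcases hf.isNilpotent_or_exists_inv K hfb hbf with ⟨m, hm⟩ | h
  swap
  · exact Or.inr h
  left
  have key (c : Λ) : IsNilpotent (c * b) := by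
    rcases hf.isNilpotent_or_exists_inv K (a := b * (c * f))
      (by rw [← mul_assoc, hfb]) (by rw [mul_assoc, mul_assoc, hf.1.eq]) with ⟨k, hk⟩ | ⟨u, -, hu⟩
    · refine ⟨k + 1, ?_⟩
      have hcomm : SemiconjBy b (c * b) (b * (c * f)) := by
        simp only [SemiconjBy, mul_assoc, hfb]
      rw [pow_succ', mul_assoc, (hcomm.pow_right k).eq, hk, zero_mul, mul_zero]
    · have hpow (k : ℕ) : b ^ k * f = 0 → f = 0 := by
        induction k with
        | zero => simp
        | succ k ih =>
          intro h
          apply ih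
          rw [← hu, ← mul_assoc, ← mul_assoc, ← pow_succ, ← mul_assoc, mul_assoc _ c f]
          have hb : b ^ (k + 1) = 0 := by rwa [pow_succ, mul_assoc, hbf, ← pow_succ] at h
          rw [hb]; simp
      exact absurd (hpow m (by rw [hm, zero_mul])) hf.2.1
  rw [radK, Submodule.restrictScalars_mem, Submodule.mem_sInf]
  intro I hI
  by_contra hbI
  obtain ⟨i, hi, z, hz, hiz⟩ := Submodule.mem_sup.1
    ((Ideal.eq_top_iff_one _).1 (hI.1.2 (I ⊔ Ideal.span {b})
      (left_lt_sup.2 fun h => hbI (h (Ideal.mem_span_singleton_self b)))))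
  obtain ⟨c, rfl⟩ := Ideal.mem_span_singleton'.1 hz
  rw [eq_sub_of_add_eq hiz] at hi
  exact hI.ne_top (Ideal.eq_top_of_isUnit_mem _ hi (key c).isUnit_one_sub)

theorem mul_mem_radK_right {K : Type} [Field K] {Λ : Type} [Ring Λ] [Algebra K Λ] {r : Λ}
    (hr : r ∈ radK K Λ) (c : Λ) : r * c ∈ radK K Λ := by
  have h : sInf {I : Ideal Λ | I.IsMaximal} = Ring.jacobson Λ := by
    simp only [Ring.jacobson, Module.jacobson, Ideal.isMaximal_def]
  rw [radK, h, Submodule.restrictScalars_mem] at hr ⊢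
  exact Ideal.mul_mem_right c _ hr

theorem mul_mem_radK_left {K : Type} [Field K] {Λ : Type} [Ring Λ] [Algebra K Λ] {r : Λ}
    (hr : r ∈ radK K Λ) (c : Λ) : c * r ∈ radK K Λ := by
  rw [radK, Submodule.restrictScalars_mem] at hr ⊢
  exact Ideal.mul_mem_left _ c hr

theorem mul_mem_radPow_succ {K : Type} [Field K] {Λ : Type} [Ring Λ] [Algebra K Λ] {n : ℕ}
    {x r : Λ} (hx : x ∈ radPow K Λ n) (hr : r ∈ radK K Λ) : x * r ∈ radPow K Λ (n + 1) := by
  cases n with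
  | zero => simpa [radPow] using mul_mem_radK_left hr x
  | succ n => rw [radPow, pow_succ]; exact Submodule.mul_mem_mul hx hr

theorem mul_mem_radPow_succ' {K : Type} [Field K] {Λ : Type} [Ring Λ] [Algebra K Λ] {n : ℕ}
    {x r : Λ} (hx : x ∈ radPow K Λ n) (hr : r ∈ radK K Λ) : r * x ∈ radPow K Λ (n + 1) := by
  cases n with
  | zero => simpa [radPow] using mul_mem_radK_right hr x
  | succ n => rw [radPow, pow_succ']; exact Submodule.mul_mem_mul hr hx

theorem mul_mem_radPow_left {K : Type} [Field K] {Λ : Type} [Ring Λ] [Algebra K Λ] {n : ℕ}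
    {x : Λ} (hx : x ∈ radPow K Λ n) (c : Λ) : c * x ∈ radPow K Λ n := by
  cases n with
  | zero => trivial
  | succ n =>
    rw [radPow, pow_succ'] at hx ⊢
    induction hx using Submodule.mul_induction_on' with
    | mem_mul_mem m hm y hy =>
      rw [← mul_assoc]; exact Submodule.mul_mem_mul (mul_mem_radK_left hm c) hy
    | add y _ z _ hy hz => rw [mul_add]; exact add_mem hy hz

end TauTilting

open TauTilting in
/-- Let `e`, `f` be primitive idempotents of `Λ` with
`eΛf ≠ 0`, and set `G^e_f := {w ∈ eΛf : wΛf = eΛf = eΛw}`.  If `G^e_f ≠ ∅`,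
then `G^e_f = eΛf \ rad^{ℓ+1}Λ`, where `ℓ` is the largest integer `m ≥ 0` such
that `eΛf ⊆ rad^m Λ` (with `rad⁰ Λ = Λ`). -/
theorem statement17
    (K : Type) [Field K]
    (Λ : Type) [Ring Λ] [Algebra K Λ] [FiniteDimensional K Λ]
    (e f : Λ) (he : IsPrimIdem Λ e) (hf : IsPrimIdem Λ f)
    (hne : ∃ x, e * x * f ≠ 0)
    (ℓ : ℕ)
    (hℓ : ∀ x : Λ, e * x * f ∈ radPow K Λ ℓ)
    (hℓ' : ¬ ∀ x : Λ, e * x * f ∈ radPow K Λ (ℓ + 1))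
    (hG : ∃ w : Λ, (∃ x, w = e * x * f) ∧
      (Set.range fun b => w * b * f) = (Set.range fun b => e * b * f) ∧
      (Set.range fun b => e * b * w) = (Set.range fun b => e * b * f)) :
    {w : Λ | (∃ x, w = e * x * f) ∧
        (Set.range fun b => w * b * f) = (Set.range fun b => e * b * f) ∧
        (Set.range fun b => e * b * w) = (Set.range fun b => e * b * f)} =
      {w : Λ | (∃ x, w = e * x * f) ∧ w ∉ radPow K Λ (ℓ + 1)} := by
  have hee := he.1.eq
  have hff := hf.1.eq
  obtain ⟨w, ⟨w', hw'⟩, hwr, hwl⟩ := hG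
  have hew : e * w = w := by rw [hw', ← mul_assoc, ← mul_assoc, hee]
  have hwf : w * f = w := by rw [hw', mul_assoc, hff]
  have hwℓ : w ∈ radPow K Λ ℓ := hw' ▸ hℓ w'
  ext x
  refine and_congr_right fun ⟨y, hy⟩ => ⟨fun ⟨_, hl⟩ hx => hℓ' fun z => ?_, fun hx => ⟨?_, ?_⟩⟩
  · obtain ⟨b, hb⟩ : e * z * f ∈ Set.range fun b => e * b * x := hl ▸ ⟨z, rfl⟩
    exact hb ▸ mul_mem_radPow_left hx (e * b)
  · obtain ⟨b, hb⟩ : x ∈ Set.range fun b => w * b * f := hwr ▸ ⟨y, hy.symm⟩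
    have hxb : w * (f * b * f) = x := by rw [← hb, ← mul_assoc, ← mul_assoc, hwf]
    rcases hf.mem_radK_or_exists_inv K (b := f * b * f) (by rw [← mul_assoc, ← mul_assoc, hff])
      (by rw [mul_assoc, hff]) with hr | ⟨u, -, hu⟩
    · exact absurd (hxb ▸ mul_mem_radPow_succ hwℓ hr) hx
    apply Set.Subset.antisymm
    · rintro _ ⟨c, rfl⟩
      exact ⟨y * f * c, by simp only [hy, mul_assoc]⟩
    · rw [← hwr]
      rintro _ ⟨c, rfl⟩
      exact ⟨u * c, by dsimp only; rw [← hxb, ← mul_assoc, mul_assoc w, hu, hwf]⟩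
  · obtain ⟨b, hb⟩ : x ∈ Set.range fun b => e * b * w := hwl ▸ ⟨y, hy.symm⟩
    have hxb : e * b * e * w = x := by rw [← hb, mul_assoc _ e w, hew]
    rcases he.mem_radK_or_exists_inv K (b := e * b * e) (by rw [← mul_assoc, ← mul_assoc, hee])
      (by rw [mul_assoc, hee]) with hr | ⟨u, hu, -⟩
    · exact absurd (hxb ▸ mul_mem_radPow_succ' hwℓ hr) hx
    apply Set.Subset.antisymm
    · rintro _ ⟨c, rfl⟩
      exact ⟨c * e * y, by simp only [hy, mul_assoc]⟩
    · rw [← hwl]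
      rintro _ ⟨c, rfl⟩
      refine ⟨c * u, ?_⟩
      dsimp only
      rw [← hxb, ← mul_assoc e c u, mul_assoc _ u, ← mul_assoc u, hu, hew]
end

section
/- Assume the bound quiver (Q,I) satisfies Condition 1 and set Λ = KQ/I. If w = α_1α_2⋯α_ℓ ∈ G(Q,I), where α_1, …, α_ℓ are arrows of Q and ℓ ≥ 2, then both α_1⋯α_{ℓ−1} and α_2⋯α_ℓ belong to G(Q,I). Consequently, G(Q,I) is closed under taking subpaths. -/
/-!
Common framework for formalizing statements from
"From support τ-tilting posets to algebras" (R. Kase).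

Modules over the basic finite dimensional algebra `Λ` are taken to be *right*
modules, encoded as (left) modules over the opposite ring `Λᵐᵒᵖ`.
τ-rigidity is encoded through the Auslander–Smalø criterion:
`Hom(M, τM) = 0` iff `Ext¹(M, Fac M) = 0`, and the vanishing of `Ext¹(M, X)`
is encoded by the splitting of all short exact sequences `0 → X → E → M → 0`.
-/

open MulOpposite

namespace TauTilting

section Corner

lemma range_op_comp {α : Type*} (F : α → α) (G : αᵐᵒᵖ → αᵐᵒᵖ) (h : ∀ b, G (op b) = op (F b)) :
    Set.range G = op '' Set.range F := by
  ext y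
  constructor
  · rintro ⟨b, rfl⟩
    exact ⟨F (unop b), ⟨_, rfl⟩, by rw [← h, op_unop]⟩
  · rintro ⟨_, ⟨b, rfl⟩, rfl⟩
    exact ⟨op b, h b⟩

variable {R : Type} [Ring R]

/-- `x` lies in the Peirce component `f R g`. -/
def InPeirce (f g x : R) : Prop := f * x = x ∧ x * g = x

lemma InPeirce.mul {f g h x y : R} (hx : InPeirce f g x) (hy : InPeirce g h y) :
    InPeirce f h (x * y) :=
  ⟨by rw [← mul_assoc, hx.1], by rw [mul_assoc, hy.2]⟩

lemma inPeirce_sandwich {f g : R} (hf : IsIdempotentElem f) (hg : IsIdempotentElem g) (x : R) :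
    InPeirce f g (f * x * g) :=
  ⟨by rw [← mul_assoc, ← mul_assoc, hf.eq], by rw [mul_assoc, hg.eq]⟩

lemma InPeirce.sandwich_eq {f g x : R} (hx : InPeirce f g x) : f * x * g = x := by
  rw [hx.1, hx.2]

lemma InPeirce.op {f g x : R} (hx : InPeirce f g x) : InPeirce (op g) (op f) (op x) :=
  ⟨by rw [← op_mul, hx.2], by rw [← op_mul, hx.1]⟩

lemma eq_pow_mul_mul_pow {a b w : R} (h : w = a * w * b) (n : ℕ) : w = a ^ n * w * b ^ n := by
  induction n with
  | zero => simp
  | succ n ih =>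
    calc w = a ^ n * (a * w * b) * b ^ n := by rw [← h]; exact ih
      _ = a ^ (n + 1) * w * b ^ (n + 1) := by
        rw [pow_succ a, pow_succ' b]; simp only [mul_assoc]

lemma eq_zero_of_eq_mul_mul_right {a b w : R} (h : w = a * w * b) (hb : IsNilpotent b) :
    w = 0 := by
  obtain ⟨n, hn⟩ := hb
  rw [eq_pow_mul_mul_pow h n, hn, mul_zero]

lemma eq_zero_of_eq_mul_mul_left {a b w : R} (h : w = a * w * b) (ha : IsNilpotent a) :
    w = 0 := by
  obtain ⟨n, hn⟩ := ha
  rw [eq_pow_mul_mul_pow h n, hn, zero_mul, zero_mul]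

/-- Every element of the corner ring `f R f` is nilpotent or invertible. -/
def NilOrUnit (f : R) : Prop :=
  ∀ x, InPeirce f f x → IsNilpotent x ∨ ∃ y, InPeirce f f y ∧ x * y = f ∧ y * x = f

/-- `f` is a nonzero idempotent whose corner ring consists of nilpotents and units. -/
structure IsFittingIdem (f : R) : Prop where
  idem : IsIdempotentElem f
  ne_zero : f ≠ 0
  nilOrUnit : NilOrUnit f

lemma IsFittingIdem.op {f : R} (hf : IsFittingIdem f) : IsFittingIdem (op f) where
  idem := by rw [IsIdempotentElem, ← op_mul, hf.idem.eq]
  ne_zero := by simpa using hf.ne_zero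
  nilOrUnit := by
    intro x hx
    have hx' : InPeirce f f (unop x) :=
      ⟨by simpa using congrArg unop hx.2, by simpa using congrArg unop hx.1⟩
    rcases hf.nilOrUnit _ hx' with ⟨n, hn⟩ | ⟨y, hy, hxy, hyx⟩
    · exact Or.inl ⟨n, by rw [← unop_inj, unop_pow, hn, unop_zero]⟩
    · exact Or.inr ⟨MulOpposite.op y, hy.op,
        by rw [← unop_inj]; simpa using hyx, by rw [← unop_inj]; simpa using hxy⟩

lemma IsFittingIdem.isNilpotent_mul_left {f a x : R} (hf : IsFittingIdem f)
    (ha : InPeirce f f a) (hx : InPeirce f f x) (hn : IsNilpotent x) : IsNilpotent (a * x) := by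
  refine (hf.nilOrUnit _ (ha.mul hx)).resolve_right ?_
  rintro ⟨c, hc, -, h⟩
  refine hf.ne_zero (eq_zero_of_eq_mul_mul_right (a := c * a) (b := x) ?_ hn)
  rw [mul_assoc, hx.1, mul_assoc, h]

lemma IsFittingIdem.isNilpotent_mul_right {f b x : R} (hf : IsFittingIdem f)
    (hb : InPeirce f f b) (hx : InPeirce f f x) (hn : IsNilpotent x) : IsNilpotent (x * b) := by
  refine (hf.nilOrUnit _ (hx.mul hb)).resolve_right ?_
  rintro ⟨c, hc, h, -⟩
  refine hf.ne_zero (eq_zero_of_eq_mul_mul_left (a := x) (b := b * c) ?_ hn)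
  rw [hx.2, ← mul_assoc, h]

lemma Gcond.ne_zero {f g x : R} (h : Gcond R f g x) : x ≠ 0 := by
  rintro rfl
  obtain ⟨h₁, -, b, hb⟩ := h
  obtain ⟨c, hc⟩ := h₁.ge ⟨b, rfl⟩
  exact hb (by simpa using hc.symm)

lemma Gcond.exists_right {f g x y : R} (hg : IsIdempotentElem g)
    (h : Gcond R f g x) (hx : InPeirce f g x) (hy : InPeirce f g y) :
    ∃ b, InPeirce g g b ∧ y = x * b := by
  obtain ⟨c, hc⟩ := h.1.ge ⟨y, rfl⟩
  refine ⟨g * c * g, inPeirce_sandwich hg hg c, ?_⟩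
  rw [← mul_assoc, ← mul_assoc, hx.2]
  exact hy.sandwich_eq.symm.trans hc.symm

lemma Gcond.exists_left {f g x y : R} (hf : IsIdempotentElem f)
    (h : Gcond R f g x) (hx : InPeirce f g x) (hy : InPeirce f g y) :
    ∃ b, InPeirce f f b ∧ y = b * x := by
  obtain ⟨c, hc⟩ := h.2.1.ge ⟨y, rfl⟩
  refine ⟨f * c * f, inPeirce_sandwich hf hf c, ?_⟩
  rw [mul_assoc, hx.1]
  exact hy.sandwich_eq.symm.trans hc.symm

lemma Gcond.of_mul_eq {f g v p a b : R} (hv : Gcond R f g v)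
    (hp : InPeirce f g p) (ha : v = p * a) (hb : v = b * p) : Gcond R f g p := by
  refine ⟨Set.Subset.antisymm ?_ ?_, Set.Subset.antisymm ?_ ?_, hv.2.2⟩
  · rintro _ ⟨c, rfl⟩
    exact ⟨p * c, by simp only [← mul_assoc, hp.1]⟩
  · rw [← hv.1]
    rintro _ ⟨c, rfl⟩
    exact ⟨a * c, by simp only [ha, mul_assoc]⟩
  · rintro _ ⟨c, rfl⟩
    exact ⟨c * p, by simp only [mul_assoc, hp.2]⟩
  · rw [← hv.2.1]
    rintro _ ⟨c, rfl⟩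
    exact ⟨c * b, by simp only [hb, mul_assoc]⟩

lemma gcond_op_iff {f g x : R} : Gcond Rᵐᵒᵖ (op g) (op f) (op x) ↔ Gcond R f g x := by
  have h₁ := range_op_comp (fun b => f * b * x) (fun b => op x * b * op f)
    (fun b => by simp only [← op_mul, mul_assoc])
  have h₂ := range_op_comp (fun b => x * b * g) (fun b => op g * b * op x)
    (fun b => by simp only [← op_mul, mul_assoc])
  have h₃ := range_op_comp (fun b => f * b * g) (fun b => op g * b * op f)
    (fun b => by simp only [← op_mul, mul_assoc])
  have h₄ : (∃ b, op g * b * op f ≠ 0) ↔ ∃ b, f * b * g ≠ 0 := by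
    rw [op_surjective.exists]
    simp only [← op_mul, ne_eq, op_eq_zero_iff, mul_assoc]
  rw [Gcond, Gcond, h₁, h₂, h₃, h₄, op_injective.image_injective.eq_iff,
    op_injective.image_injective.eq_iff]
  tauto

/-- A left factor of a generator is a generator, provided the relevant Peirce components
have generators at all. -/
lemma Gcond.of_mul_left {f g h p q u v : R} (hf : IsFittingIdem f) (hg : IsFittingIdem g)
    (hh : IsFittingIdem h) (hp : InPeirce f g p) (hq : InPeirce g h q)
    (hv' : InPeirce f g v) (hv : Gcond R f g v) (hu' : InPeirce g h u) (hu : Gcond R g h u)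
    (hw : Gcond R f h (p * q)) : Gcond R f g p := by
  have hpq := hp.mul hq
  obtain ⟨x, hx, rfl⟩ := hv.exists_right hg.idem hv' hp
  obtain ⟨x', hx', hpx'⟩ := hv.exists_left hf.idem hv' hp
  rcases hg.nilOrUnit x hx with hn | ⟨a, ha, hxa, -⟩
  · exfalso
    obtain ⟨z, hz, hxz⟩ := hu.exists_right hh.idem hu' (hx.mul hu')
    obtain ⟨y, hy, rfl⟩ := hu.exists_right hh.idem hu' hq
    obtain ⟨t, ht, hvt⟩ := hw.exists_right hh.idem hpq (hv'.mul hu')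
    have hzn : IsNilpotent z := by
      refine (hh.nilOrUnit z hz).resolve_right ?_
      rintro ⟨c, -, hzc, -⟩
      refine hu.ne_zero (eq_zero_of_eq_mul_mul_left (a := x) (b := c) ?_ hn)
      rw [hxz, mul_assoc, hzc, hu'.2]
    have htzy : IsNilpotent (t * (z * y)) :=
      hh.isNilpotent_mul_left ht (hz.mul hy) (hh.isNilpotent_mul_right hy hz hzn)
    refine hw.ne_zero (eq_zero_of_eq_mul_mul_right (a := 1) ?_ htzy)
    calc v * x * (u * y) = v * (x * u) * y := by simp only [mul_assoc]
      _ = v * u * (z * y) := by rw [hxz]; simp only [mul_assoc]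
      _ = 1 * (v * x * (u * y)) * (t * (z * y)) := by
        rw [hvt, one_mul, mul_assoc (v * x * (u * y)) t]
  · rcases hf.nilOrUnit x' hx' with hn | ⟨b, hb, -, hbx⟩
    · exfalso
      obtain ⟨s, hs, hvs⟩ := hw.exists_left hf.idem hpq (hv'.mul hq)
      refine hw.ne_zero (eq_zero_of_eq_mul_mul_left (b := 1) ?_
        (hf.isNilpotent_mul_right hs hx' hn))
      calc v * x * q = x' * (v * q) := by rw [hpx', mul_assoc]
        _ = x' * s * (v * x * q) * 1 := by rw [hvs, mul_one, ← mul_assoc x' s]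
    · exact hv.of_mul_eq hp (a := a) (b := b) (by rw [mul_assoc, hxa, hv'.2])
        (by rw [hpx', ← mul_assoc, hbx, hv'.1])

lemma Gcond.of_mul_right {f g h p q u v : R} (hf : IsFittingIdem f) (hg : IsFittingIdem g)
    (hh : IsFittingIdem h) (hp : InPeirce f g p) (hq : InPeirce g h q)
    (hv' : InPeirce f g v) (hv : Gcond R f g v) (hu' : InPeirce g h u) (hu : Gcond R g h u)
    (hw : Gcond R f h (p * q)) : Gcond R g h q :=
  gcond_op_iff.1 <| Gcond.of_mul_left hh.op hg.op hf.op hq.op hp.op hu'.op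
    (gcond_op_iff.2 hu) hv'.op (gcond_op_iff.2 hv)
    (by rw [← op_mul]; exact gcond_op_iff.2 hw)

lemma exists_pow_succ_mul_eq (K : Type) [Field K] [Algebra K R] [FiniteDimensional K R] (x : R) :
    ∃ (n : ℕ) (g : R), Commute x g ∧ x ^ (n + 1) * g = x ^ n := by
  have : IsArtinianRing (Algebra.adjoin K {x}) := IsArtinianRing.of_finite K _
  let x' : Algebra.adjoin K {x} := ⟨x, Algebra.self_mem_adjoin_singleton K x⟩
  have : IsMulCommutative (Algebra.adjoin K {x}) := Algebra.isMulCommutative_adjoin K (by simp)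
  obtain ⟨n, g, hg⟩ := IsArtinian.exists_pow_succ_smul_dvd x' (1 : Algebra.adjoin K {x})
  refine ⟨n, g, congrArg Subtype.val (mul_comm x' g), ?_⟩
  simpa [x'] using congrArg Subtype.val hg

/-- Primitive idempotents of a finite dimensional algebra have nil-or-unit corner rings. -/
lemma IsPrimIdem.isFittingIdem (K : Type) [Field K] [Algebra K R] [FiniteDimensional K R]
    {f : R} (hf : IsPrimIdem R f) : IsFittingIdem f := by
  refine ⟨hf.1, hf.2.1, fun x hx => ?_⟩
  obtain ⟨n, g, hc, hg⟩ := exists_pow_succ_mul_eq K x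
  have hpow : ∀ m, x ^ (n + m) * g ^ m = x ^ n := by
    intro m
    induction m with
    | zero => simp
    | succ m ih =>
      calc x ^ (n + (m + 1)) * g ^ (m + 1) = x ^ m * (x ^ (n + 1) * g) * g ^ m := by
            rw [pow_succ' g, ← mul_assoc, ← mul_assoc, ← pow_add]; congr 3; ring
        _ = x ^ n := by rw [hg, ← pow_add, add_comm m n, ih]
  have hfx : f * x ^ (n + 1) = x ^ (n + 1) := by rw [pow_succ', ← mul_assoc, hx.1]
  have hxf : x ^ (n + 1) * f = x ^ (n + 1) := by rw [pow_succ, mul_assoc, hx.2]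
  set d := x ^ (n + 1) * g ^ (n + 1) with hd
  have hcomm : d = g ^ (n + 1) * x ^ (n + 1) := (hc.pow_pow _ _).eq
  have hxd : x ^ (n + 1) * d = x ^ (n + 1) := by
    rw [hd, ← mul_assoc, ← pow_add]
    calc x ^ (n + 1 + (n + 1)) * g ^ (n + 1) = x * (x ^ (n + (n + 1)) * g ^ (n + 1)) := by
          rw [← mul_assoc, ← pow_succ']; congr 2; ring
      _ = x ^ (n + 1) := by rw [hpow, pow_succ']
  have hdd : d * d = d := by
    conv_lhs => rw [hcomm]
    rw [mul_assoc, ← hcomm, hxd, ← hcomm]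
  have hfd : f * d = d := by rw [hd, ← mul_assoc, hfx]
  have hdf : d * f = d := by rw [hcomm, mul_assoc, hxf]
  rcases hf.2.2 d (f - d) hdd
      (by simp [IsIdempotentElem, mul_sub, sub_mul, hf.1.eq, hdd, hfd, hdf])
      (by rw [mul_sub, hdf, hdd, sub_self]) (by rw [sub_mul, hfd, hdd, sub_self])
      (by abel) with h | h
  · exact Or.inl ⟨n + 1, by rw [← hxd, h, mul_zero]⟩
  · have hdeq : d = f := (sub_eq_zero.1 h).symm
    have hxy : x * (x ^ n * g ^ (n + 1)) = f := by rw [← mul_assoc, ← pow_succ', ← hd, hdeq]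
    have hyx : (x ^ n * g ^ (n + 1)) * x = f := by
      rw [← hxy]
      exact (((Commute.refl x).pow_right n).mul_right (hc.pow_right _)).eq.symm
    refine Or.inr ⟨f * (x ^ n * g ^ (n + 1)) * f, inPeirce_sandwich hf.1 hf.1 _, ?_, ?_⟩
    · rw [← mul_assoc, ← mul_assoc, hx.2, hxy, hf.1.eq]
    · rw [mul_assoc, hx.1, mul_assoc, hyx, hf.1.eq]

end Corner

section Path

variable {ι : Type} {Arr : ι → ι → Type}

lemma QPath.verts_sublist_append_right {i j k : ι} (p : QPath Arr i j) (q : QPath Arr j k) :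
    q.verts.Sublist (p.append q).verts := by
  induction p with
  | nil i => exact List.Sublist.refl _
  | cons a p ih => exact (ih q).cons _

lemma QPath.verts_sublist_append_left {i j k : ι} (p : QPath Arr i j) (q : QPath Arr j k) :
    p.verts.Sublist (p.append q).verts := by
  induction p with
  | nil i =>
    cases q with
    | nil => exact List.Sublist.refl _
    | cons a q => exact (List.nil_sublist _).cons_cons _
  | cons a p ih => exact (ih q).cons_cons _

variable {R : Type} [Ring R] {e : ι → R} {arr : ∀ i j, Arr i j → R}

lemma QPath.eval_inPeirce (he : ∀ i, IsIdempotentElem (e i))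
    (harr : ∀ i j (a : Arr i j), InPeirce (e i) (e j) (arr i j a)) {i j : ι}
    (p : QPath Arr i j) : InPeirce (e i) (e j) (p.eval e arr) := by
  induction p with
  | nil i => exact ⟨(he i).eq, (he i).eq⟩
  | cons a p ih => exact (harr _ _ a).mul ih

lemma QPath.eval_append (he : ∀ i, IsIdempotentElem (e i))
    (harr : ∀ i j (a : Arr i j), InPeirce (e i) (e j) (arr i j a)) {i j k : ι}
    (p : QPath Arr i j) (q : QPath Arr j k) :
    (p.append q).eval e arr = p.eval e arr * q.eval e arr := by
  induction p with
  | nil i => exact (q.eval_inPeirce he harr).1.symm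
  | cons a p ih => simp only [QPath.append, QPath.eval, ih, mul_assoc]

lemma GMem.of_append (he : ∀ i, IsFittingIdem (e i))
    (harr : ∀ i j (a : Arr i j), InPeirce (e i) (e j) (arr i j a)) (hc : Cond1 R e arr)
    {i j k : ι} (p : QPath Arr i j) (q : QPath Arr j k) (h : GMem R e arr (p.append q)) :
    GMem R e arr p ∧ GMem R e arr q := by
  have hi i := (he i).idem
  have hP {i j : ι} (r : QPath Arr i j) := r.eval_inPeirce hi harr
  obtain ⟨hnd, hG⟩ := h
  rw [QPath.eval_append hi harr] at hG
  obtain ⟨v, -, hv⟩ := hc i j ⟨p.eval e arr, by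
    rw [(hP p).sandwich_eq]; exact left_ne_zero_of_mul hG.ne_zero⟩
  obtain ⟨u, -, hu⟩ := hc j k ⟨q.eval e arr, by
    rw [(hP q).sandwich_eq]; exact right_ne_zero_of_mul hG.ne_zero⟩
  exact ⟨⟨(p.verts_sublist_append_left q).nodup hnd,
      .of_mul_left (he i) (he j) (he k) (hP p) (hP q) (hP v) hv (hP u) hu hG⟩,
    ⟨(p.verts_sublist_append_right q).nodup hnd,
      .of_mul_right (he i) (he j) (he k) (hP p) (hP q) (hP v) hv (hP u) hu hG⟩⟩

end Path

end TauTilting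

open TauTilting in
/-- Assume `(Q, I)` satisfies Condition 1 and let
`Λ = KQ/I`.  If `w = α₁α₂⋯α_ℓ ∈ G(Q,I)` with `ℓ ≥ 2`, then both
`α₁⋯α_{ℓ-1}` and `α₂⋯α_ℓ` belong to `G(Q,I)`.  Consequently `G(Q,I)` is closed
under taking (contiguous) subpaths. -/
theorem statement18
    (K : Type) [Field K]
    (Λ : Type) [Ring Λ] [Algebra K Λ] [FiniteDimensional K Λ]
    (ι : Type) [Fintype ι] [DecidableEq ι] (e : ι → Λ)
    (Arr : ι → ι → Type) [∀ i j, Fintype (Arr i j)] (arr : ∀ i j, Arr i j → Λ)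
    (hpres : IsGabrielPres Λ K e Arr arr)
    (hc1 : Cond1 Λ e arr) :
    -- dropping the last arrow
    (∀ (i j k : ι) (p : QPath Arr i j) (a : Arr j k),
      GMem Λ e arr (p.append (QPath.single a)) → GMem Λ e arr p) ∧
    -- dropping the first arrow
    (∀ (i j k : ι) (a : Arr i j) (p : QPath Arr j k),
      GMem Λ e arr (QPath.cons a p) → GMem Λ e arr p) ∧
    -- consequently: closure under contiguous subpaths
    (∀ (i j k l : ι) (p : QPath Arr i j) (q : QPath Arr j k) (r : QPath Arr k l),
      GMem Λ e arr (p.append (q.append r)) → GMem Λ e arr q) := by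
  have he i : IsFittingIdem (e i) := (hpres.1.1 i).isFittingIdem K
  have harr i j (a : Arr i j) : InPeirce (e i) (e j) (arr i j a) := by
    rw [← (hpres.2.2.1 i j a).2]
    exact inPeirce_sandwich (he i).idem (he j).idem _
  refine ⟨fun i j k p a h => (GMem.of_append he harr hc1 p _ h).1,
    fun i j k a p h => (GMem.of_append he harr hc1 (.single a) p h).2,
    fun i j k l p q r h => ?_⟩
  exact (GMem.of_append he harr hc1 q r (GMem.of_append he harr hc1 p _ h).2).1
end
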